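/- Under the setting of the previous lemma (L = ℋ(x) rank-r, μ-incoherent with condition number κ; s α-sparse with α ≤ c/(μ c_s r κ)² for a small absolute constant c; z = x + s; τ = 4αμ c_s r κ; β = μ c_s r/(2κn); 4τ + √(1/12) ≤ γ < 1; L_k rank-r and 4μκ²-incoherent with ‖L − L_k‖₂ ≤ 2τγ^kσ_r and ‖x − x_k‖_∞ ≤ ((τ − 2τ²)/(8ακn))γ^kσ_r; ζ_{k+1} = βγ^kσ₁(L_k); s_{k+1} = T_{ζ_{k+1}}(z − x_k)), defining L_{k+1} = D_r(P_{T_k}ℋ(z − s_{k+1})) as a best rank-r approximation of P_{T_k}ℋ(z − s_{k+1}), it holds that ‖L − L_{k+1}‖₂ ≤ 2τγ^{k+1}σ_r. -/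

import Mathlib

open Matrix
open scoped BigOperators

noncomputable section

namespace ASAP

/-- The Hankel operator `ℋ : ℂⁿ → ℂ^{n₁×n₂}`, `[ℋ(x)]_{i,j} = x_{i+j}`. -/
def hankel {n₁ n₂ n : ℕ} (hn : n + 1 = n₁ + n₂) (x : Fin n → ℂ) :
    Matrix (Fin n₁) (Fin n₂) ℂ :=
  Matrix.of fun i j => x ⟨i.1 + j.1, by have hi := i.2; have hj := j.2; omega⟩

open Classical in
/-- The left inverse `ℋ†` of the Hankel operator: averages over antidiagonals. -/
def hankelDagger {n₁ n₂ n : ℕ} (_hn : n + 1 = n₁ + n₂)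
    (M : Matrix (Fin n₁) (Fin n₂) ℂ) : Fin n → ℂ := fun t =>
  (((Finset.univ.filter fun p : Fin n₁ × Fin n₂ => p.1.1 + p.2.1 = t.1).card : ℂ))⁻¹ *
    ∑ p ∈ Finset.univ.filter fun p : Fin n₁ × Fin n₂ => p.1.1 + p.2.1 = t.1, M p.1 p.2

/-- Spectral norm (largest singular value) of a matrix. -/
def specNorm {m n : Type*} [Fintype m] [Fintype n] [DecidableEq n]
    (M : Matrix m n ℂ) : ℝ :=
  ‖LinearMap.toContinuousLinearMap (Matrix.toEuclideanLin M)‖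

/-- Frobenius norm of a matrix. -/
def frobNorm {m n : Type*} [Fintype m] [Fintype n] (M : Matrix m n ℂ) : ℝ :=
  Real.sqrt (∑ i, ∑ j, ‖M i j‖ ^ 2)

/-- `‖·‖_{2,∞}`: maximum ℓ₂ norm of the rows of a matrix. -/
def rowNorm {m n : Type*} [Fintype m] [Fintype n] (M : Matrix m n ℂ) : ℝ :=
  ⨆ i, Real.sqrt (∑ j, ‖M i j‖ ^ 2)

/-- Entrywise max norm of a matrix. -/
def maxNorm {m n : Type*} [Fintype m] [Fintype n] (M : Matrix m n ℂ) : ℝ :=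
  ⨆ i, ⨆ j, ‖M i j‖

/-- ℓ∞ norm of a vector. -/
def vecMaxNorm {n : Type*} [Fintype n] (v : n → ℂ) : ℝ :=
  ⨆ t, ‖v t‖

/-- ℓ₂ norm of a vector. -/
def vecTwoNorm {n : Type*} [Fintype n] (v : n → ℂ) : ℝ :=
  Real.sqrt (∑ t, ‖v t‖ ^ 2)

/-- The augmented Hermitian matrix `[[0, M], [Mᴴ, 0]]`. -/
def aug {m n : Type*} (M : Matrix m n ℂ) : Matrix (m ⊕ n) (m ⊕ n) ℂ :=
  Matrix.fromBlocks 0 M Mᴴ 0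

open Classical in
/-- Support (set of indices of nonzero entries) of a vector. -/
def supp {n : Type*} [Fintype n] (v : n → ℂ) : Finset n :=
  Finset.univ.filter fun t => v t ≠ 0

/-- `α`-sparsity: at most `α·n` nonzero entries. -/
def IsSparse {n : ℕ} (α : ℝ) (s : Fin n → ℂ) : Prop :=
  ((supp s).card : ℝ) ≤ α * n

/-- The hard thresholding operator `T_ζ`. -/
def hardThreshold {n : ℕ} (ζ : ℝ) (v : Fin n → ℂ) : Fin n → ℂ := fun t =>
  if ζ < ‖v t‖ then v t else 0

/-- `c_s = max {n/n₁, n/n₂}`. -/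
def csConst (n₁ n₂ n : ℕ) : ℝ :=
  max ((n : ℝ) / n₁) ((n : ℝ) / n₂)

/-- `(U, σ, V)` is a (compact, rank-`r`, positive and ordered) singular value
decomposition of `L`, i.e. `L = U Σ V*` with orthonormal columns. -/
def IsSVD {m n : Type*} [Fintype m] [Fintype n] {r : ℕ}
    (L : Matrix m n ℂ) (U : Matrix m (Fin r) ℂ) (σ : Fin r → ℝ)
    (V : Matrix n (Fin r) ℂ) : Prop :=
  Uᴴ * U = 1 ∧ Vᴴ * V = 1 ∧ (∀ i, 0 < σ i) ∧ (∀ i j : Fin r, i ≤ j → σ j ≤ σ i) ∧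
    L = U * Matrix.diagonal (fun i => (σ i : ℂ)) * Vᴴ

/-- `μ`-incoherence of a rank-`r` matrix (with respect to `c_s` and `n`). -/
def IsIncoherent {m n' : Type*} [Fintype m] [Fintype n'] (r n : ℕ) (μ cs : ℝ)
    (L : Matrix m n' ℂ) : Prop :=
  ∃ (U : Matrix m (Fin r) ℂ) (σ : Fin r → ℝ) (V : Matrix n' (Fin r) ℂ),
    IsSVD L U σ V ∧ rowNorm U ≤ Real.sqrt (μ * cs * r / n) ∧
      rowNorm V ≤ Real.sqrt (μ * cs * r / n)

/-- Orthogonal projection onto the tangent space determined by `U` and `V`: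
`P_T M = UU*M + MVV* − UU*MVV*`. -/
def tangentProj {m n : Type*} [Fintype m] [Fintype n] {r : ℕ}
    (U : Matrix m (Fin r) ℂ) (V : Matrix n (Fin r) ℂ)
    (M : Matrix m n ℂ) : Matrix m n ℂ :=
  U * Uᴴ * M + M * (V * Vᴴ) - U * Uᴴ * M * (V * Vᴴ)

/-- `L` is a best rank-`r` approximation of `A` with respect to the norm `nrm`. -/
def IsBestApproxWrt {m n : Type*} [Fintype m] [Fintype n] (r : ℕ)
    (nrm : Matrix m n ℂ → ℝ) (A L : Matrix m n ℂ) : Prop :=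
  L.rank ≤ r ∧ ∀ B : Matrix m n ℂ, B.rank ≤ r → nrm (A - L) ≤ nrm (A - B)

/-- Best rank-`r` approximation in Frobenius norm (truncated SVD, `D_r`). -/
def IsBestRankApprox {m n : Type*} [Fintype m] [Fintype n] (r : ℕ)
    (A L : Matrix m n ℂ) : Prop :=
  IsBestApproxWrt r frobNorm A L

/-- Horizontal concatenation of two matrices. -/
def hcat {m a b : Type*} (A : Matrix m a ℂ) (B : Matrix m b ℂ) :
    Matrix m (a ⊕ b) ℂ :=
  Matrix.of fun i => Sum.elim (A i) (B i)


section Helpers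

set_option linter.unusedSectionVars false

open scoped Matrix.Norms.L2Operator

/-- Squared Euclidean norm. -/
def nsq {m : Type*} [Fintype m] (v : m → ℂ) : ℝ := ∑ i, ‖v i‖ ^ 2

/-- Real part of the inner product. -/
def ip {m : Type*} [Fintype m] (v w : m → ℂ) : ℝ := (star v ⬝ᵥ w).re

variable {m n l : Type*} [Fintype m] [Fintype n] [Fintype l]

theorem nsq_nonneg (v : m → ℂ) : 0 ≤ nsq v := Finset.sum_nonneg fun _ _ => by positivity

theorem nsq_eq_zero {v : m → ℂ} (h : nsq v = 0) : v = 0 := by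
  unfold nsq at h
  rw [Finset.sum_eq_zero_iff_of_nonneg (fun _ _ => by positivity)] at h
  funext i
  simpa using h i (Finset.mem_univ i)

theorem nsq_eq_norm (v : m → ℂ) : nsq v = ‖WithLp.toLp 2 v‖ ^ 2 := by
  rw [EuclideanSpace.norm_sq_eq]; rfl

theorem dot_self (v : m → ℂ) : star v ⬝ᵥ v = (nsq v : ℂ) := by
  unfold nsq
  simp only [dotProduct, Pi.star_apply]
  push_cast
  refine Finset.sum_congr rfl fun i _ => ?_
  have := Complex.conj_mul' (v i)
  simpa using this

theorem ip_self (v : m → ℂ) : ip v v = nsq v := by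
  simp [ip, dot_self]

theorem ip_comm (v w : m → ℂ) : ip v w = ip w v := by
  unfold ip
  simp only [dotProduct, Complex.re_sum, Pi.star_apply]
  refine Finset.sum_congr rfl fun i _ => ?_
  simp
  ring

theorem nsq_add (v w : m → ℂ) : nsq (v + w) = nsq v + 2 * ip v w + nsq w := by
  have h := ip_comm v w
  rw [← ip_self, ← ip_self, ← ip_self]
  unfold ip at *
  simp only [star_add, add_dotProduct, dotProduct_add, Complex.add_re]
  linarith

theorem nsq_csmul (c : ℂ) (v : m → ℂ) : nsq (c • v) = ‖c‖ ^ 2 * nsq v := by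
  unfold nsq
  rw [Finset.mul_sum]
  refine Finset.sum_congr rfl fun i _ => ?_
  simp [mul_pow]

theorem ip_rsmul (c : ℝ) (v w : m → ℂ) : ip v ((c : ℂ) • w) = c * ip v w := by
  simp [ip, dotProduct_smul]

theorem dot_conj (A : Matrix m n ℂ) (y : m → ℂ) (u : n → ℂ) :
    star (Aᴴ *ᵥ y) ⬝ᵥ u = star y ⬝ᵥ (A *ᵥ u) := by
  rw [star_mulVec, conjTranspose_conjTranspose, dotProduct_mulVec]

theorem ip_conj (A : Matrix m n ℂ) (y : m → ℂ) (u : n → ℂ) :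
    ip (Aᴴ *ᵥ y) u = ip y (A *ᵥ u) := by
  unfold ip; rw [dot_conj]

theorem nsq_comb (a b : ℝ) (v w : m → ℂ) :
    nsq ((a : ℂ) • v + (b : ℂ) • w) = a ^ 2 * nsq v + 2 * a * b * ip v w + b ^ 2 * nsq w := by
  rw [nsq_add, nsq_csmul, nsq_csmul, ip_rsmul, ip_comm, ip_rsmul, ip_comm]
  simp only [Complex.norm_real, Real.norm_eq_abs, sq_abs]
  ring

variable [DecidableEq m] [DecidableEq n] [DecidableEq l]

theorem specNorm_eq (A : Matrix m n ℂ) : specNorm A = ‖A‖ := rfl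

theorem nsq_mulVec_le (A : Matrix m n ℂ) (v : n → ℂ) : nsq (A *ᵥ v) ≤ ‖A‖ ^ 2 * nsq v := by
  rw [nsq_eq_norm, nsq_eq_norm, ← mul_pow]
  exact pow_le_pow_left₀ (norm_nonneg _) (l2_opNorm_mulVec A (WithLp.toLp 2 v)) 2

theorem norm_le_of_nsq (A : Matrix m n ℂ) (C : ℝ) (hC : 0 ≤ C)
    (h : ∀ v, nsq (A *ᵥ v) ≤ C ^ 2 * nsq v) : ‖A‖ ≤ C := by
  rw [l2_opNorm_def]
  refine ContinuousLinearMap.opNorm_le_bound _ hC fun v => ?_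
  have := h v.ofLp
  rw [nsq_eq_norm, nsq_eq_norm, ← mul_pow] at this
  exact le_of_sq_le_sq this (by positivity)

theorem norm_le_one_of_isometry (U : Matrix m n ℂ) (h : Uᴴ * U = 1) : ‖U‖ ≤ 1 := by
  refine norm_le_of_nsq U 1 zero_le_one fun v => ?_
  rw [← ip_self, ← ip_conj, mulVec_mulVec, h, one_mulVec, ip_self]; simp

theorem norm_le_one_of_proj (P : Matrix m m ℂ) (h1 : Pᴴ = P) (h2 : P * P = P) : ‖P‖ ≤ 1 := by
  have := l2_opNorm_conjTranspose_mul_self P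
  rw [h1, h2] at this
  nlinarith [norm_nonneg P]

/-- The `√(4/3)` bound for the tangent-space projection. -/
theorem tangent_bound (P : Matrix m m ℂ) (Q : Matrix n n ℂ) (E : Matrix m n ℂ)
    (hP : Pᴴ = P) (hP2 : P * P = P) (hQ : Qᴴ = Q) (hQ2 : Q * Q = Q) :
    ‖P * E + E * Q - P * E * Q‖ ≤ Real.sqrt (4 / 3) * ‖E‖ := by
  rcases eq_or_lt_of_le (norm_nonneg E) with h0 | hC
  · have : E = 0 := norm_eq_zero.mp h0.symm
    simp [this]
  set C := ‖E‖ with hCdef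
  refine norm_le_of_nsq _ _ (by positivity) fun w => ?_
  rw [mul_pow, Real.sq_sqrt (by norm_num)]
  have pyth : ∀ z : m → ℂ, nsq (P *ᵥ z) + nsq (z - P *ᵥ z) = nsq z := by
    intro z
    have e : z = P *ᵥ z + (z - P *ᵥ z) := by abel
    have o : ip (P *ᵥ z) (z - P *ᵥ z) = 0 := by
      have := ip_conj P z (z - P *ᵥ z)
      rw [hP] at this
      rw [this, mulVec_sub, mulVec_mulVec, hP2, sub_self]; simp [ip]
    conv_rhs => rw [e, nsq_add, o]
    ring
  have pythQ : ∀ z : n → ℂ, nsq (Q *ᵥ z) + nsq (z - Q *ᵥ z) = nsq z := by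
    intro z
    have e : z = Q *ᵥ z + (z - Q *ᵥ z) := by abel
    have o : ip (Q *ᵥ z) (z - Q *ᵥ z) = 0 := by
      have := ip_conj Q z (z - Q *ᵥ z)
      rw [hQ] at this
      rw [this, mulVec_sub, mulVec_mulVec, hQ2, sub_self]; simp [ip]
    conv_rhs => rw [e, nsq_add, o]
    ring
  have hPP : ∀ z : m → ℂ, P *ᵥ (P *ᵥ z) = P *ᵥ z := fun z => by rw [mulVec_mulVec, hP2]
  have hQQ : ∀ z : n → ℂ, Q *ᵥ (Q *ᵥ z) = Q *ᵥ z := fun z => by rw [mulVec_mulVec, hQ2]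
  set u := Q *ᵥ w with hu
  set v := w - Q *ᵥ w with hv
  set a := P *ᵥ (E *ᵥ u) with ha
  set c := E *ᵥ u - P *ᵥ (E *ᵥ u) with hc
  set y := P *ᵥ (E *ᵥ w) with hy
  set p := Q *ᵥ (Eᴴ *ᵥ y) with hp
  set q := Eᴴ *ᵥ y - Q *ᵥ (Eᴴ *ᵥ y) with hq
  have hPy : P *ᵥ y = y := by rw [hy, mulVec_mulVec, hP2]
  have hN : (P * E + E * Q - P * E * Q) *ᵥ w = y + c := by
    rw [sub_mulVec, add_mulVec, hy, hc, hu]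
    simp only [mulVec_mulVec, Matrix.mul_assoc]
    abel
  have oyc : ip y c = 0 := by
    have := ip_conj P (E *ᵥ w) c
    rw [hP] at this
    rw [hy, this, hc, mulVec_sub, hPP, sub_self]
    simp [ip]
  rw [hN, nsq_add, oyc]
  have h1 : nsq a + nsq c ≤ C ^ 2 * nsq u := by
    rw [ha, hc, pyth]; exact nsq_mulVec_le E u
  have h2 : nsq p + nsq q ≤ C ^ 2 * nsq y := by
    rw [hp, hq, pythQ]
    have := nsq_mulVec_le Eᴴ y
    rwa [l2_opNorm_conjTranspose] at this
  have h3 : nsq u + nsq v = nsq w := pythQ w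
  have h4 : ip y a = ip y (E *ᵥ u) := by
    have := ip_conj P y (E *ᵥ u)
    rw [hP, hPy] at this
    exact this.symm
  have h5 : ip p u = ip y a := by
    rw [h4, ← ip_conj E, hp]
    have := ip_conj Q (Eᴴ *ᵥ y) u
    rw [hQ] at this
    rw [this, hu, hQQ]
  have h6 : nsq y = ip y a + ip q v := by
    have e1 : ip q v = ip (Eᴴ *ᵥ y) v := by
      have e : Eᴴ *ᵥ y = p + q := by rw [hp, hq]; abel
      have o : ip p v = 0 := by
        have := ip_conj Q (Eᴴ *ᵥ y) v
        rw [hQ] at this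
        rw [hp, this, hv, mulVec_sub, hQQ, sub_self]; simp [ip]
      rw [e]
      unfold ip at *
      rw [star_add, add_dotProduct, Complex.add_re, o, zero_add]
    have e2 : w = u + v := by rw [hu, hv]; abel
    have e3 : nsq y = ip y (E *ᵥ w) := by
      have := ip_conj P y (E *ᵥ w)
      rw [hP, hPy] at this
      rw [this, ← hy, ip_self]
    rw [e1, ip_conj, h4, e3]
    conv_lhs => rw [e2]
    unfold ip
    rw [mulVec_add, dotProduct_add, Complex.add_re]
  have s1 := nsq_nonneg (((1 : ℝ) : ℂ) • a + ((-(1/2) : ℝ) : ℂ) • y)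
  have s2 := nsq_nonneg (((C : ℝ) : ℂ) • u + ((-(3/(2*C)) : ℝ) : ℂ) • p)
  have s3 := nsq_nonneg (((C : ℝ) : ℂ) • v + ((-(3/(4*C)) : ℝ) : ℂ) • q)
  rw [nsq_comb] at s1 s2 s3
  rw [ip_comm a y] at s1
  rw [ip_comm u p, h5] at s2
  rw [ip_comm v q] at s3
  have e2 : 2 * C * (-(3/(2*C))) = -3 := by field_simp
  have e3 : 2 * C * (-(3/(4*C))) = -(3/2) := by field_simp; norm_num
  rw [e2] at s2
  rw [e3] at s3
  have h2' : nsq p / C ^ 2 + nsq q / C ^ 2 ≤ nsq y := by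
    rw [← add_div, div_le_iff₀ (by positivity)]; linarith
  have e4 : (-(3/(2*C))) ^ 2 * nsq p = 9 / 4 * (nsq p / C ^ 2) := by field_simp; ring
  have e5 : (-(3/(4*C))) ^ 2 * nsq q = 9 / 16 * (nsq q / C ^ 2) := by field_simp; ring
  rw [e4] at s2
  rw [e5] at s3
  rw [← h3]
  nlinarith

/-- Squared Frobenius norm. -/
def fsq (A : Matrix m n ℂ) : ℝ := ∑ i, ∑ j, ‖A i j‖ ^ 2

/-- Real Frobenius inner product. -/
def fip (A B : Matrix m n ℂ) : ℝ := (∑ i, ∑ j, star (A i j) * B i j).re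

theorem fsq_nonneg (A : Matrix m n ℂ) : 0 ≤ fsq A :=
  Finset.sum_nonneg fun _ _ => Finset.sum_nonneg fun _ _ => by positivity

theorem fsq_eq_zero {A : Matrix m n ℂ} (h : fsq A = 0) : A = 0 := by
  unfold fsq at h
  rw [Finset.sum_eq_zero_iff_of_nonneg
    (fun _ _ => Finset.sum_nonneg fun _ _ => by positivity)] at h
  ext i j
  have := h i (Finset.mem_univ i)
  rw [Finset.sum_eq_zero_iff_of_nonneg (fun _ _ => by positivity)] at this
  simpa using this j (Finset.mem_univ j)

theorem fip_self (A : Matrix m n ℂ) : fip A A = fsq A := by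
  unfold fip fsq
  rw [Complex.re_sum]
  refine Finset.sum_congr rfl fun i _ => ?_
  rw [Complex.re_sum]
  refine Finset.sum_congr rfl fun j _ => ?_
  have := Complex.conj_mul' (A i j)
  have h2 : star (A i j) * A i j = ((‖A i j‖ ^ 2 : ℝ) : ℂ) := by simpa using this
  rw [h2, Complex.ofReal_re]

theorem fsq_sub (A B : Matrix m n ℂ) : fsq (A - B) = fsq A - 2 * fip A B + fsq B := by
  rw [← fip_self, ← fip_self, ← fip_self]
  unfold fip
  simp only [Complex.re_sum]
  rw [Finset.mul_sum, ← Finset.sum_sub_distrib, ← Finset.sum_add_distrib]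
  refine Finset.sum_congr rfl fun i _ => ?_
  rw [Finset.mul_sum, ← Finset.sum_sub_distrib, ← Finset.sum_add_distrib]
  refine Finset.sum_congr rfl fun j _ => ?_
  simp
  ring

theorem fip_rsmul (t : ℝ) (A B : Matrix m n ℂ) : fip A ((t : ℂ) • B) = t * fip A B := by
  unfold fip
  simp only [Complex.re_sum]
  rw [Finset.mul_sum]
  refine Finset.sum_congr rfl fun i _ => ?_
  rw [Finset.mul_sum]
  refine Finset.sum_congr rfl fun j _ => ?_
  simp
  ring

theorem fsq_rsmul (t : ℝ) (B : Matrix m n ℂ) : fsq ((t : ℂ) • B) = t ^ 2 * fsq B := by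
  unfold fsq
  rw [Finset.mul_sum]
  refine Finset.sum_congr rfl fun i _ => ?_
  rw [Finset.mul_sum]
  refine Finset.sum_congr rfl fun j _ => ?_
  simp [mul_pow]

theorem fip_trace (A B : Matrix m n ℂ) : fip A B = (Matrix.trace (Aᴴ * B)).re := by
  unfold fip
  congr 1
  rw [Finset.sum_comm]
  simp [Matrix.trace, Matrix.mul_apply]

theorem fip_vecMulVec (A : Matrix m n ℂ) (a : m → ℂ) (w : n → ℂ) :
    fip A (vecMulVec a (star w)) = ip (A *ᵥ w) a := by
  unfold fip ip
  congr 1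
  simp only [dotProduct, Pi.star_apply, mulVec, vecMulVec_apply, star_sum, Finset.sum_mul]
  refine Finset.sum_congr rfl fun i _ => Finset.sum_congr rfl fun j _ => ?_
  simp
  ring

theorem fsq_vecMulVec (a : m → ℂ) (w : n → ℂ) :
    fsq (vecMulVec a (star w)) = nsq a * nsq w := by
  unfold fsq nsq
  rw [Finset.sum_mul]
  refine Finset.sum_congr rfl fun i _ => ?_
  rw [Finset.mul_sum]
  refine Finset.sum_congr rfl fun j _ => ?_
  simp [vecMulVec_apply, mul_pow]

theorem rank_add_le' (A B : Matrix m n ℂ) : (A + B).rank ≤ A.rank + B.rank := by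
  unfold Matrix.rank
  rw [Matrix.mulVecLin_add]
  refine le_trans (Submodule.finrank_mono (LinearMap.range_add_le _ _)) ?_
  exact Submodule.finrank_add_le_finrank_add_finrank _ _

open scoped ComplexOrder in
theorem rank_ct (A : Matrix m n ℂ) : Aᴴ.rank = A.rank := rank_conjTranspose A

/-- Removing a row-space direction lowers the rank. -/
theorem rank_deflate (X : Matrix m n ℂ) (y : m → ℂ) (hw : nsq (Xᴴ *ᵥ y) = 1) :
    (X - vecMulVec (X *ᵥ (Xᴴ *ᵥ y)) (star (Xᴴ *ᵥ y))).rank < X.rank := by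
  set w := Xᴴ *ᵥ y with hwdef
  rw [← rank_ct, ← rank_ct X]
  have hd : star w ⬝ᵥ w = 1 := by rw [dot_self, hw]; simp
  have key : ∀ z, (X - vecMulVec (X *ᵥ w) (star w))ᴴ *ᵥ z
      = Xᴴ *ᵥ z - (star w ⬝ᵥ (Xᴴ *ᵥ z)) • w := by
    intro z
    rw [conjTranspose_sub, sub_mulVec, conjTranspose_vecMulVec, star_star]
    congr 1
    rw [vecMulVec_mulVec, star_mulVec, ← dotProduct_mulVec]
    ext i
    simp [mul_comm]
  unfold Matrix.rank
  refine Submodule.finrank_lt_finrank_of_lt (lt_of_le_of_ne ?_ ?_)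
  · rintro _ ⟨z, rfl⟩
    simp only [mulVecLin_apply]
    rw [key]
    refine Submodule.sub_mem _ ⟨z, rfl⟩ (Submodule.smul_mem _ _ ⟨y, rfl⟩)
  · intro h
    have hm : w ∈ LinearMap.range (Xᴴ).mulVecLin := ⟨y, rfl⟩
    rw [← h] at hm
    obtain ⟨z, hz⟩ := hm
    simp only [mulVecLin_apply] at hz
    rw [key] at hz
    have : star w ⬝ᵥ w = 0 := by
      have h2 := congrArg (fun q => star w ⬝ᵥ q) hz
      rw [dotProduct_sub, dotProduct_smul, hd] at h2
      rw [hd, ← h2]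
      simp
    rw [hd] at this
    exact one_ne_zero this

theorem crit (R G : Matrix m n ℂ) (h : ∀ t : ℝ, fsq R ≤ fsq (R - (t : ℂ) • G)) :
    fip R G = 0 := by
  set g := fip R G with hg
  have h1 : ∀ t : ℝ, 2 * t * g ≤ t ^ 2 * fsq G := by
    intro t
    have := h t
    rw [fsq_sub, fip_rsmul, fsq_rsmul, ← hg] at this
    linarith
  have h2 := h1 (g / (fsq G + 1))
  have hp := fsq_nonneg G
  rw [div_pow] at h2
  have h3 : 2 * g * (g * (fsq G + 1)) ≤ g ^ 2 * fsq G := by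
    have hpos : 0 < fsq G + 1 := by linarith
    have := mul_le_mul_of_nonneg_right h2 (by positivity : 0 ≤ (fsq G + 1) ^ 2)
    field_simp at this
    nlinarith
  nlinarith [mul_nonneg hp (sq_nonneg g), sq_nonneg g]

/-- A best Frobenius rank-`r` approximation is at least as good in spectral norm as any
rank-`r` matrix. -/
theorem best_approx_spec (r : ℕ) (M X B : Matrix m n ℂ) (hX : IsBestRankApprox r M X)
    (hB : B.rank ≤ r) : ‖M - X‖ ≤ ‖M - B‖ := by
  obtain ⟨hXr, hbest⟩ := hX
  set R := M - X with hR
  have hmin : ∀ D : Matrix m n ℂ, (X + D).rank ≤ r → fsq R ≤ fsq (R - D) := by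
    intro D hD
    have h := hbest (X + D) hD
    have e : M - (X + D) = R - D := by rw [hR]; abel
    rw [e] at h
    exact (Real.sqrt_le_sqrt_iff (fsq_nonneg _)).1 h
  clear_value R
  have o1 : Xᴴ * R = 0 := by
    have : fip R (X * (Xᴴ * R)) = 0 := by
      refine crit _ _ fun t => hmin _ ?_
      have e : X + (t : ℂ) • (X * (Xᴴ * R)) = X * (1 + (t : ℂ) • (Xᴴ * R)) := by
        rw [Matrix.mul_add, Matrix.mul_one, Matrix.mul_smul]
      rw [e]
      exact (rank_mul_le_left _ _).trans hXr
    apply fsq_eq_zero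
    rw [← fip_self, fip_trace, conjTranspose_mul, conjTranspose_conjTranspose, Matrix.mul_assoc,
      ← fip_trace, this]
  have o2 : R * Xᴴ = 0 := by
    have : fip R ((R * Xᴴ) * X) = 0 := by
      refine crit _ _ fun t => hmin _ ?_
      have e : X + (t : ℂ) • ((R * Xᴴ) * X) = (1 + (t : ℂ) • (R * Xᴴ)) * X := by
        rw [Matrix.add_mul, Matrix.one_mul, Matrix.smul_mul]
      rw [e]
      exact (rank_mul_le_right _ _).trans hXr
    apply fsq_eq_zero
    rw [← fip_self, fip_trace, conjTranspose_mul, conjTranspose_conjTranspose, Matrix.mul_assoc,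
      trace_mul_comm, Matrix.mul_assoc, ← fip_trace, this]
  have o3 : X * Rᴴ = 0 := by
    have := congrArg conjTranspose o2
    simpa using this
  have hRX : ∀ a b, star (R *ᵥ a) ⬝ᵥ (X *ᵥ b) = 0 := by
    intro a b
    have := dot_conj Rᴴ a (X *ᵥ b)
    have h1 : Rᴴ * X = 0 := by
      have := congrArg conjTranspose o1
      simpa using this
    rw [star_mulVec, ← dotProduct_mulVec, mulVec_mulVec, h1]; simp
  -- the main comparison
  have comp : ∀ (v w : n → ℂ), nsq v = 1 → nsq w ≤ 1 →
      (X - vecMulVec (X *ᵥ w) (star w)).rank + 1 ≤ r → nsq (R *ᵥ v) ≤ nsq (X *ᵥ w) := by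
    intro v w hv hw hrk
    have h := hmin (vecMulVec (R *ᵥ v) (star v) - vecMulVec (X *ᵥ w) (star w)) (by
      have e : X + (vecMulVec (R *ᵥ v) (star v) - vecMulVec (X *ᵥ w) (star w))
        = (X - vecMulVec (X *ᵥ w) (star w)) + vecMulVec (R *ᵥ v) (star v) := by abel
      rw [e]
      refine (rank_add_le' _ _).trans (le_trans ?_ hrk)
      exact Nat.add_le_add_left (rank_vecMulVec_le _ _) _)
    have e : R - (vecMulVec (R *ᵥ v) (star v) - vecMulVec (X *ᵥ w) (star w))
      = (R - vecMulVec (R *ᵥ v) (star v)) - vecMulVec (-(X *ᵥ w)) (star w) := by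
      rw [neg_vecMulVec]; abel
    rw [e, fsq_sub, fsq_sub, fip_vecMulVec, fip_vecMulVec, fsq_vecMulVec, fsq_vecMulVec, hv,
      ip_self] at h
    have z : ip ((R - vecMulVec (R *ᵥ v) (star v)) *ᵥ w) (-(X *ᵥ w)) = 0 := by
      have e2 : (R - vecMulVec (R *ᵥ v) (star v)) *ᵥ w = R *ᵥ (w - (star v ⬝ᵥ w) • v) := by
        rw [sub_mulVec, vecMulVec_mulVec, mulVec_sub, mulVec_smul]
        congr 1
        ext i
        simp [mul_comm]
      unfold ip
      rw [e2, dotProduct_neg, hRX]; simp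
    have e3 : nsq (-(X *ᵥ w)) = nsq (X *ᵥ w) := by simp [nsq]
    rw [z, e3] at h
    nlinarith [nsq_nonneg (X *ᵥ w)]
  set C := ‖M - B‖ with hC
  have main : ∀ u : m → ℂ, nsq (Rᴴ *ᵥ u) = 1 → nsq (R *ᵥ (Rᴴ *ᵥ u)) ≤ C ^ 2 := by
    intro u hu
    set v := Rᴴ *ᵥ u with hv
    rcases lt_or_eq_of_le hXr with hlt | heq
    · have := comp v 0 hu (by simp [nsq]) (by simpa using hlt)
      have h0 : nsq (X *ᵥ (0 : n → ℂ)) = 0 := by simp [nsq]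
      rw [h0] at this
      exact this.trans (sq_nonneg _)
    have hXw : ∀ y : m → ℂ,
        nsq (R *ᵥ v) * nsq (Xᴴ *ᵥ y) ≤ nsq (X *ᵥ (Xᴴ *ᵥ y)) := by
      intro y
      rcases eq_or_lt_of_le (nsq_nonneg (Xᴴ *ᵥ y)) with h0 | hpos
      · rw [← h0, mul_zero]; exact nsq_nonneg _
      set N := nsq (Xᴴ *ᵥ y) with hN
      set t : ℝ := (Real.sqrt N)⁻¹ with ht
      have ht2 : t ^ 2 = N⁻¹ := by rw [ht, inv_pow, Real.sq_sqrt hpos.le]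
      have hw1 : nsq (Xᴴ *ᵥ ((t : ℂ) • y)) = 1 := by
        rw [mulVec_smul, nsq_csmul, Complex.norm_real, Real.norm_eq_abs, sq_abs, ht2, ← hN]
        field_simp
      have h := comp v _ hu hw1.le (by
        have := rank_deflate X _ hw1
        omega)
      rw [mulVec_smul, mulVec_smul, nsq_csmul, Complex.norm_real, Real.norm_eq_abs, sq_abs,
        ht2] at h
      rw [mul_comm]
      calc N * nsq (R *ᵥ v) ≤ N * (N⁻¹ * nsq (X *ᵥ (Xᴴ *ᵥ y))) :=
            mul_le_mul_of_nonneg_left h hpos.le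
        _ = _ := by field_simp
    let S := LinearMap.range (Xᴴ).mulVecLin
    let f : (S × ℂ) →ₗ[ℂ] (m → ℂ) :=
      B.mulVecLin ∘ₗ (S.subtype.coprod (LinearMap.toSpanSingleton ℂ (n → ℂ) v))
    have hfr : Module.finrank ℂ (LinearMap.range f) ≤ r :=
      (Submodule.finrank_mono (LinearMap.range_comp_le_range _ _)).trans hB
    have hdim : Module.finrank ℂ (S × ℂ) = r + 1 := by
      rw [Module.finrank_prod, Module.finrank_self]
      have : Module.finrank ℂ S = r := by
        rw [← heq, ← rank_ct]; rfl
      rw [this]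
    have hker : LinearMap.ker f ≠ ⊥ := by
      intro hb
      have := LinearMap.finrank_range_add_finrank_ker f
      rw [hb, finrank_bot, hdim] at this
      omega
    obtain ⟨⟨⟨w, z, hz⟩, t⟩, hmem, hne⟩ := Submodule.exists_mem_ne_zero_of_ne_bot hker
    have hBy : B *ᵥ (w + t • v) = 0 := by
      simpa [f] using hmem
    simp only [mulVecLin_apply] at hz
    have hRw : R *ᵥ w = 0 := by rw [← hz, mulVec_mulVec, o2, zero_mulVec]
    have hXv : X *ᵥ v = 0 := by rw [hv, mulVec_mulVec, o3, zero_mulVec]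
    have hMy : (M - B) *ᵥ (w + t • v) = X *ᵥ w + t • (R *ᵥ v) := by
      have : M = X + R := by rw [hR]; abel
      rw [sub_mulVec, hBy, sub_zero, this, add_mulVec, mulVec_add, mulVec_add, hRw, mulVec_smul,
        hXv, mulVec_smul]
      simp
    have hn := nsq_mulVec_le (M - B) (w + t • v)
    have c1 : ip (X *ᵥ w) (t • (R *ᵥ v)) = 0 := by
      rw [ip_comm, ← mulVec_smul]; unfold ip; rw [hRX]; simp
    have c2 : ip w (t • v) = 0 := by
      rw [← hz, ip_conj, mulVec_smul, hXv]; simp [ip]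
    rw [hMy, nsq_add, nsq_add, c1, c2, nsq_csmul, nsq_csmul, hu, ← hC] at hn
    have hw := hXw z
    rw [hz] at hw
    have hpos : 0 < nsq w + ‖t‖ ^ 2 := by
      rcases eq_or_lt_of_le (nsq_nonneg w) with h0 | hp
      · have hw0 := nsq_eq_zero h0.symm
        have ht0 : t ≠ 0 := by
          rintro rfl
          apply hne
          subst hw0
          rfl
        rw [← h0]
        have := norm_pos_iff.2 ht0
        positivity
      · positivity
    have : nsq (R *ᵥ v) * (nsq w + ‖t‖ ^ 2) ≤ C ^ 2 * (nsq w + ‖t‖ ^ 2) := by nlinarith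
    exact le_of_mul_le_mul_right this hpos
  have main2 : ∀ u : m → ℂ, nsq (R *ᵥ (Rᴴ *ᵥ u)) ≤ C ^ 2 * nsq (Rᴴ *ᵥ u) := by
    intro u
    rcases eq_or_lt_of_le (nsq_nonneg (Rᴴ *ᵥ u)) with h0 | hpos
    · rw [nsq_eq_zero h0.symm]; simp [nsq]
    set N := nsq (Rᴴ *ᵥ u) with hN
    set t : ℝ := (Real.sqrt N)⁻¹ with ht
    have ht2 : t ^ 2 = N⁻¹ := by rw [ht, inv_pow, Real.sq_sqrt hpos.le]
    have h := main ((t : ℂ) • u) (by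
      rw [mulVec_smul, nsq_csmul, Complex.norm_real, Real.norm_eq_abs, sq_abs, ht2, ← hN]
      field_simp)
    rw [mulVec_smul, mulVec_smul, nsq_csmul, Complex.norm_real, Real.norm_eq_abs, sq_abs,
      ht2] at h
    calc _ = (N⁻¹ * nsq (R *ᵥ (Rᴴ *ᵥ u))) * N := by field_simp
      _ ≤ C ^ 2 * N := mul_le_mul_of_nonneg_right h hpos.le
  have hC0 : 0 ≤ C := norm_nonneg _
  have h3 : ‖R * Rᴴ‖ ≤ C * ‖R‖ := by
    refine norm_le_of_nsq _ _ (by positivity) fun u => ?_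
    rw [← mulVec_mulVec, mul_pow, mul_assoc]
    refine (main2 u).trans (mul_le_mul_of_nonneg_left ?_ (sq_nonneg _))
    have := nsq_mulVec_le Rᴴ u
    rwa [l2_opNorm_conjTranspose] at this
  have h4 := l2_opNorm_conjTranspose_mul_self Rᴴ
  rw [conjTranspose_conjTranspose, l2_opNorm_conjTranspose] at h4
  rw [h4] at h3
  rcases eq_or_lt_of_le (norm_nonneg R) with h0 | hp
  · rw [← h0]; exact hC0
  · exact le_of_mul_le_mul_right h3 hp

theorem best_approx_spec' (r : ℕ) (M X B : Matrix m n ℂ) (hX : IsBestRankApprox r M X)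
    (hB : B.rank ≤ r) : specNorm (M - X) ≤ specNorm (M - B) := best_approx_spec r M X B hX hB

/-- Schur test. -/
theorem schur_test (E : Matrix m n ℂ) (A : ℝ) (hA : 0 ≤ A) (hrow : ∀ i, ∑ j, ‖E i j‖ ≤ A)
    (hcol : ∀ j, ∑ i, ‖E i j‖ ≤ A) : ‖E‖ ≤ A := by
  refine norm_le_of_nsq E A hA fun v => ?_
  have h1 : ∀ i, ‖(E *ᵥ v) i‖ ^ 2 ≤ A * ∑ j, ‖E i j‖ * ‖v j‖ ^ 2 := by
    intro i
    have a1 : ‖(E *ᵥ v) i‖ ≤ ∑ j, ‖E i j‖ * ‖v j‖ := by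
      simp only [mulVec, dotProduct]
      refine (norm_sum_le _ _).trans (le_of_eq ?_)
      simp
    have a2 := pow_le_pow_left₀ (norm_nonneg _) a1 2
    have a3 : (∑ j, ‖E i j‖ * ‖v j‖) ^ 2 ≤ (∑ j, ‖E i j‖) * ∑ j, ‖E i j‖ * ‖v j‖ ^ 2 :=
      Finset.sum_sq_le_sum_mul_sum_of_sq_le_mul _ (fun _ _ => by positivity)
        (fun _ _ => by positivity) (fun _ _ => le_of_eq (by ring))
    refine a2.trans (a3.trans (mul_le_mul_of_nonneg_right (hrow i) ?_))
    exact Finset.sum_nonneg fun _ _ => by positivity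
  unfold nsq
  calc ∑ i, ‖(E *ᵥ v) i‖ ^ 2 ≤ ∑ i, A * ∑ j, ‖E i j‖ * ‖v j‖ ^ 2 :=
        Finset.sum_le_sum fun i _ => h1 i
    _ = A * ∑ j, (∑ i, ‖E i j‖) * ‖v j‖ ^ 2 := by
        rw [← Finset.mul_sum, Finset.sum_comm]
        simp only [Finset.sum_mul]
    _ ≤ A * ∑ j, A * ‖v j‖ ^ 2 := by
        refine mul_le_mul_of_nonneg_left (Finset.sum_le_sum fun j _ => ?_) hA
        exact mul_le_mul_of_nonneg_right (hcol j) (by positivity)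
    _ = _ := by rw [← Finset.mul_sum]; ring

theorem hankel_norm_le {n₁ n₂ n : ℕ} (hn : n + 1 = n₁ + n₂) (e : Fin n → ℂ) :
    specNorm (hankel hn e) ≤ ∑ t, ‖e t‖ := by
  rw [specNorm_eq]
  refine schur_test _ _ (Finset.sum_nonneg fun _ _ => norm_nonneg _) (fun i => ?_) (fun j => ?_)
  · let f : Fin n₂ → Fin n := fun j => ⟨i.1 + j.1, by have hi := i.2; have hj := j.2; omega⟩
    have hf : Function.Injective f := by
      intro a b hab
      have : i.1 + a.1 = i.1 + b.1 := congrArg Fin.val hab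
      ext; omega
    calc ∑ j, ‖hankel hn e i j‖ = ∑ t ∈ Finset.univ.map ⟨f, hf⟩, ‖e t‖ := by
          rw [Finset.sum_map]; rfl
      _ ≤ _ := Finset.sum_le_sum_of_subset_of_nonneg (Finset.subset_univ _)
          fun _ _ _ => norm_nonneg _
  · let f : Fin n₁ → Fin n := fun i => ⟨i.1 + j.1, by have hi := i.2; have hj := j.2; omega⟩
    have hf : Function.Injective f := by
      intro a b hab
      have : a.1 + j.1 = b.1 + j.1 := congrArg Fin.val hab
      ext; omega
    calc ∑ i, ‖hankel hn e i j‖ = ∑ t ∈ Finset.univ.map ⟨f, hf⟩, ‖e t‖ := by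
          rw [Finset.sum_map]; rfl
      _ ≤ _ := Finset.sum_le_sum_of_subset_of_nonneg (Finset.subset_univ _)
          fun _ _ _ => norm_nonneg _

/-- The thresholding step: support containment and entrywise bound. -/
theorem thresh_bound {n : ℕ} (x s xk : Fin n → ℂ) (ζ b : ℝ) (hx : ∀ t, ‖x t - xk t‖ ≤ b)
    (hb : b ≤ ζ) :
    ∑ t, ‖(s - hardThreshold ζ (x + s - xk)) t‖ ≤ (supp s).card * (ζ + b) := by
  classical
  rw [← nsmul_eq_mul, ← Finset.sum_const]
  have h0 : ∀ t, t ∉ supp s → ‖(s - hardThreshold ζ (x + s - xk)) t‖ = 0 := by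
    intro t ht
    have hst : s t = 0 := by simpa [supp] using ht
    have : ¬ ζ < ‖(x + s - xk) t‖ := by
      simp only [Pi.sub_apply, Pi.add_apply, hst, add_zero, not_lt]
      exact (hx t).trans hb
    rw [Pi.sub_apply, hst]
    unfold hardThreshold
    rw [if_neg this]; simp
  rw [← Finset.sum_subset (Finset.subset_univ (supp s)) (fun t _ ht => h0 t ht)]
  refine Finset.sum_le_sum fun t _ => ?_
  have e1 : (s - hardThreshold ζ (x + s - xk)) t
      = ((x + s - xk) t - hardThreshold ζ (x + s - xk) t) - (x t - xk t) := by
    simp only [Pi.sub_apply, Pi.add_apply]; ring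
  rw [e1]
  refine (norm_sub_le _ _).trans (add_le_add ?_ (hx t))
  unfold hardThreshold
  split_ifs with h
  · rw [sub_self, norm_zero]
    exact ((norm_nonneg _).trans (hx t)).trans hb
  · rw [sub_zero]; exact not_lt.1 h

theorem svd_norm {r : ℕ} (hr : 0 < r) {L : Matrix m n ℂ} {U : Matrix m (Fin r) ℂ}
    {σ : Fin r → ℝ} {V : Matrix n (Fin r) ℂ} (h : IsSVD L U σ V) : specNorm L = σ ⟨0, hr⟩ := by
  rw [specNorm_eq]
  obtain ⟨hU, hV, hpos, hord, hL⟩ := h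
  have hD : ‖(Matrix.diagonal (fun i => (σ i : ℂ)) : Matrix (Fin r) (Fin r) ℂ)‖ = σ ⟨0, hr⟩ := by
    rw [l2_opNorm_diagonal]
    apply le_antisymm
    · refine (pi_norm_le_iff_of_nonneg (hpos _).le).2 fun i => ?_
      rw [Complex.norm_real, Real.norm_eq_abs, abs_of_pos (hpos i)]
      exact hord _ _ (Fin.mk_le_mk.2 (Nat.zero_le _))
    · have := norm_le_pi_norm (fun i => (σ i : ℂ)) ⟨0, hr⟩
      rwa [Complex.norm_real, Real.norm_eq_abs, abs_of_pos (hpos _)] at this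
  have nU := norm_le_one_of_isometry U hU
  have nV := norm_le_one_of_isometry V hV
  apply le_antisymm
  · rw [hL, ← hD]
    refine (l2_opNorm_mul _ _).trans ?_
    rw [l2_opNorm_conjTranspose]
    have := l2_opNorm_mul U (Matrix.diagonal (fun i => (σ i : ℂ)))
    have p := norm_nonneg (Matrix.diagonal (fun i => (σ i : ℂ)) : Matrix (Fin r) (Fin r) ℂ)
    calc _ ≤ (‖U‖ * ‖(Matrix.diagonal (fun i => (σ i : ℂ)) : Matrix (Fin r) (Fin r) ℂ)‖) * ‖V‖ :=
          mul_le_mul_of_nonneg_right this (norm_nonneg _)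
      _ ≤ (1 * ‖(Matrix.diagonal (fun i => (σ i : ℂ)) : Matrix (Fin r) (Fin r) ℂ)‖) * 1 := by
          gcongr
      _ = _ := by ring
  · have e : Uᴴ * L * V = Matrix.diagonal (fun i => (σ i : ℂ)) := by
      rw [hL]
      calc _ = (Uᴴ * U) * Matrix.diagonal (fun i => (σ i : ℂ)) * (Vᴴ * V) := by
            simp only [Matrix.mul_assoc]
        _ = _ := by rw [hU, hV]; simp
    rw [← hD, ← e]
    have h1 := l2_opNorm_mul (Uᴴ * L) V
    have h2 := l2_opNorm_mul Uᴴ L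
    rw [l2_opNorm_conjTranspose] at h2
    calc _ ≤ _ := h1
      _ ≤ (‖U‖ * ‖L‖) * ‖V‖ := mul_le_mul_of_nonneg_right h2 (norm_nonneg _)
      _ ≤ (1 * ‖L‖) * 1 := by gcongr
      _ = _ := by ring

theorem tangent_residual {r : ℕ} (hr : 0 < r) {L Lk : Matrix m n ℂ} {U Uk : Matrix m (Fin r) ℂ}
    {σ σk : Fin r → ℝ} {V Vk : Matrix n (Fin r) ℂ} (h : IsSVD L U σ V)
    (hk : IsSVD Lk Uk σk Vk) (E : Matrix m n ℂ) :
    specNorm (L - tangentProj Uk Vk (L + E)) ≤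
      specNorm (L - Lk) ^ 2 / σ ⟨r - 1, by omega⟩ + Real.sqrt (4 / 3) * specNorm E := by
  obtain ⟨hU, hV, hpos, hord, hL⟩ := h
  obtain ⟨hUk, hVk, -, -, hLk⟩ := hk
  simp only [specNorm_eq]
  set P := Uk * Ukᴴ with hP
  set Q := Vk * Vkᴴ with hQ
  have P1 : Pᴴ = P := by rw [hP]; simp
  have Q1 : Qᴴ = Q := by rw [hQ]; simp
  have PU : P * Uk = Uk := by rw [hP, Matrix.mul_assoc, hUk, Matrix.mul_one]
  have QV : Vkᴴ * Q = Vkᴴ := by rw [hQ, ← Matrix.mul_assoc, hVk, Matrix.one_mul]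
  have P2 : P * P = P := by
    conv_lhs => rw [hP, ← Matrix.mul_assoc, ← hP, PU]
  have Q2 : Q * Q = Q := by
    conv_lhs => rw [hQ, Matrix.mul_assoc, ← hQ, QV]
  have hPL : (1 - P) * Lk = 0 := by
    rw [hLk, Matrix.mul_assoc, ← Matrix.mul_assoc, Matrix.sub_mul, PU]; simp
  have hQL : Lk * (1 - Q) = 0 := by
    rw [hLk, Matrix.mul_assoc, Matrix.mul_sub, QV]; simp
  set D : Matrix (Fin r) (Fin r) ℂ := Matrix.diagonal (fun i => (σ i : ℂ)) with hD
  set D' : Matrix (Fin r) (Fin r) ℂ := Matrix.diagonal (fun i => ((σ i)⁻¹ : ℂ)) with hD'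
  have hDD : D * D' = 1 := by
    rw [hD, hD', diagonal_mul_diagonal, ← diagonal_one]
    congr 1
    funext i
    exact mul_inv_cancel₀ (by exact_mod_cast (hpos i).ne')
  have hinv : L * (V * D' * Uᴴ) * L = L := by
    rw [hL]
    calc _ = U * (D * (Vᴴ * V) * D') * (Uᴴ * U) * D * Vᴴ := by simp only [Matrix.mul_assoc]
      _ = _ := by rw [hU, hV, Matrix.mul_one, Matrix.mul_one, hDD, Matrix.mul_one]
  set sr := σ ⟨r - 1, by omega⟩ with hsr
  have hsr0 : 0 < sr := hpos _
  have nD' : ‖D'‖ ≤ sr⁻¹ := by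
    rw [hD', l2_opNorm_diagonal]
    refine (pi_norm_le_iff_of_nonneg (by positivity)).2 fun i => ?_
    rw [norm_inv, Complex.norm_real, Real.norm_eq_abs, abs_of_pos (hpos i)]
    refine inv_anti₀ hsr0 (hord _ _ (Fin.mk_le_mk.2 ?_))
    have := i.2
    omega
  have nU := norm_le_one_of_isometry U hU
  have nV := norm_le_one_of_isometry V hV
  have nPinv : ‖V * D' * Uᴴ‖ ≤ sr⁻¹ := by
    have h1 := l2_opNorm_mul (V * D') Uᴴ
    have h2 := l2_opNorm_mul V D'
    rw [l2_opNorm_conjTranspose] at h1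
    calc _ ≤ _ := h1
      _ ≤ (‖V‖ * ‖D'‖) * ‖U‖ := mul_le_mul_of_nonneg_right h2 (norm_nonneg _)
      _ ≤ (1 * sr⁻¹) * 1 := by gcongr
      _ = _ := by ring
  have nP : ‖1 - P‖ ≤ 1 := norm_le_one_of_proj _ (by simp [P1]) (by
    rw [Matrix.mul_sub, Matrix.sub_mul, Matrix.sub_mul, P2]; simp)
  have nQ : ‖1 - Q‖ ≤ 1 := norm_le_one_of_proj _ (by simp [Q1]) (by
    rw [Matrix.mul_sub, Matrix.sub_mul, Matrix.sub_mul, Q2]; simp)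
  have nA : ‖(1 - P) * L‖ ≤ ‖L - Lk‖ := by
    have e : (1 - P) * L = (1 - P) * (L - Lk) := by rw [Matrix.mul_sub, hPL, sub_zero]
    rw [e]
    refine (l2_opNorm_mul _ _).trans ?_
    nlinarith [norm_nonneg (L - Lk)]
  have nB : ‖L * (1 - Q)‖ ≤ ‖L - Lk‖ := by
    have e : L * (1 - Q) = (L - Lk) * (1 - Q) := by rw [Matrix.sub_mul, hQL, sub_zero]
    rw [e]
    refine (l2_opNorm_mul _ _).trans ?_
    nlinarith [norm_nonneg (L - Lk)]
  have nR : ‖(1 - P) * L * (1 - Q)‖ ≤ ‖L - Lk‖ ^ 2 / sr := by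
    have e : (1 - P) * L * (1 - Q) = ((1 - P) * L) * (V * D' * Uᴴ) * (L * (1 - Q)) := by
      conv_lhs => rw [← hinv]
      simp only [Matrix.mul_assoc]
    rw [e]
    have h1 := l2_opNorm_mul (((1 - P) * L) * (V * D' * Uᴴ)) (L * (1 - Q))
    have h2 := l2_opNorm_mul ((1 - P) * L) (V * D' * Uᴴ)
    calc _ ≤ _ := h1
      _ ≤ (‖(1 - P) * L‖ * ‖V * D' * Uᴴ‖) * ‖L * (1 - Q)‖ :=
          mul_le_mul_of_nonneg_right h2 (norm_nonneg _)
      _ ≤ (‖L - Lk‖ * sr⁻¹) * ‖L - Lk‖ := by gcongr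
      _ = _ := by rw [div_eq_mul_inv]; ring
  have split : L - tangentProj Uk Vk (L + E)
      = (1 - P) * L * (1 - Q) - (P * E + E * Q - P * E * Q) := by
    unfold tangentProj
    rw [← hP, ← hQ]
    simp only [Matrix.mul_add, Matrix.add_mul, Matrix.mul_sub, Matrix.sub_mul, Matrix.one_mul,
      Matrix.mul_one]
    abel
  rw [split]
  exact (norm_sub_le _ _).trans (add_le_add nR (tangent_bound P Q E P1 P2 Q1 Q2))

theorem specNorm_nonneg (A : Matrix m n ℂ) : 0 ≤ specNorm A := norm_nonneg A

theorem specNorm_sub_rev (A B : Matrix m n ℂ) : specNorm (A - B) = specNorm (B - A) :=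
  norm_sub_rev A B

theorem specNorm_tri (A B C : Matrix m n ℂ) :
    specNorm (A - C) ≤ specNorm (A - B) + specNorm (B - C) :=
  norm_sub_le_norm_sub_add_norm_sub A B C

theorem specNorm_abs_sub (A B : Matrix m n ℂ) :
    |specNorm A - specNorm B| ≤ specNorm (A - B) := abs_norm_sub_norm_le A B

end Helpers

set_option maxHeartbeats 1000000 in
/-- spectral norm contraction for the next iterate `L_{k+1}`. -/
theorem statement14 :
    ∃ c : ℝ, 0 < c ∧
    ∀ (n₁ n₂ n r : ℕ) (hn : n + 1 = n₁ + n₂), 0 < n₁ → 0 < n₂ → (hr : 0 < r) →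
    ∀ (μ α κ cs τ β : ℝ), 0 < μ → 0 < α →
    ∀ (x s : Fin n → ℂ)
      (U : Matrix (Fin n₁) (Fin r) ℂ) (σ : Fin r → ℝ) (V : Matrix (Fin n₂) (Fin r) ℂ),
      IsSVD (hankel hn x) U σ V →
      cs = csConst n₁ n₂ n →
      rowNorm U ≤ Real.sqrt (μ * cs * r / n) →
      rowNorm V ≤ Real.sqrt (μ * cs * r / n) →
      κ = σ ⟨0, hr⟩ / σ ⟨r - 1, by omega⟩ →
      IsSparse α s →
      α ≤ c / (μ * cs * r * κ) ^ 2 →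
      τ = 4 * α * μ * cs * r * κ →
      β = μ * cs * r / (2 * κ * n) →
    ∀ γ : ℝ, 4 * τ + Real.sqrt (1 / 12) ≤ γ → γ < 1 →
    ∀ (k : ℕ) (Lk : Matrix (Fin n₁) (Fin n₂) ℂ) (xk : Fin n → ℂ)
      (Uk : Matrix (Fin n₁) (Fin r) ℂ) (σk : Fin r → ℝ) (Vk : Matrix (Fin n₂) (Fin r) ℂ),
      IsSVD Lk Uk σk Vk →
      rowNorm Uk ≤ Real.sqrt (4 * μ * κ ^ 2 * cs * r / n) →
      rowNorm Vk ≤ Real.sqrt (4 * μ * κ ^ 2 * cs * r / n) →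
      specNorm (hankel hn x - Lk) ≤ 2 * τ * γ ^ k * σ ⟨r - 1, by omega⟩ →
      vecMaxNorm (x - xk) ≤ (τ - 2 * τ ^ 2) / (8 * α * κ * n) * γ ^ k * σ ⟨r - 1, by omega⟩ →
    ∀ Lk1 : Matrix (Fin n₁) (Fin n₂) ℂ,
      IsBestRankApprox r
        (tangentProj Uk Vk (hankel hn
          (x + s - hardThreshold (β * γ ^ k * specNorm Lk) (x + s - xk)))) Lk1 →
      specNorm (hankel hn x - Lk1) ≤ 2 * τ * γ ^ (k + 1) * σ ⟨r - 1, by omega⟩ := by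
  refine ⟨1, one_pos, ?_⟩
  intro n₁ n₂ n r hn hn₁ hn₂ hr μ α κ cs τ β hμ hα x s U σ V hSVD hcs _ _ hκ hs _ hτ hβ γ hγ hγ1
    k Lk xk Uk σk Vk hSVDk _ _ hLk hxk Lk1 hLk1
  set sr := σ ⟨r - 1, by omega⟩ with hsr
  have hsr0 : 0 < sr := hSVD.2.2.1 _
  have hn0 : 0 < n := by omega
  have hnR : (0 : ℝ) < n := by exact_mod_cast hn0
  have hrR : (0 : ℝ) < r := by exact_mod_cast hr
  have hcs0 : 0 < cs := by
    rw [hcs]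
    have : (0 : ℝ) < n₁ := by exact_mod_cast hn₁
    exact lt_max_of_lt_left (by positivity)
  have hs1 : σ ⟨0, hr⟩ = κ * sr := by rw [hκ]; field_simp
  have hκ1 : 1 ≤ κ := by
    rw [hκ, le_div_iff₀ hsr0, one_mul]
    exact hSVD.2.2.2.1 _ _ (Fin.mk_le_mk.2 (Nat.zero_le _))
  have hτ0 : 0 < τ := by rw [hτ]; positivity
  have hsq : 0 ≤ Real.sqrt (1 / 12) := Real.sqrt_nonneg _
  have hγ0 : 0 < γ := by linarith
  have hτ4 : τ < 1 / 4 := by linarith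
  set g := γ ^ k with hg
  have hg0 : 0 < g := by positivity
  have hg1 : g ≤ 1 := pow_le_one₀ hγ0.le hγ1.le
  obtain ⟨mm, hmm⟩ : ∃ mm, mm = μ * cs * r := ⟨_, rfl⟩
  have hmm0 : 0 < mm := by rw [hmm]; positivity
  have hτm : τ = 4 * α * mm * κ := by rw [hτ, hmm]; ring
  have hκ0 : 0 < κ := by linarith
  have hL1 : specNorm (hankel hn x) = κ * sr := by rw [svd_norm hr hSVD, hs1]
  set ζ := β * g * specNorm Lk with hζ
  have hβ2 : β = mm / (2 * κ * n) := by rw [hβ, hmm]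
  have hβ0 : 0 < β := by rw [hβ2]; positivity
  have hdiff : |specNorm (hankel hn x) - specNorm Lk| ≤ 2 * τ * g * sr :=
    (specNorm_abs_sub (hankel hn x) Lk).trans hLk
  rw [hL1, abs_le] at hdiff
  have hgs : 2 * τ * g * sr ≤ 2 * τ * sr := by
    have : τ * sr * g ≤ τ * sr * 1 := mul_le_mul_of_nonneg_left hg1 (by positivity)
    linarith
  have hκs : 2 * τ * sr ≤ 2 * τ * (κ * sr) := by
    have : sr ≤ κ * sr := by nlinarith
    exact mul_le_mul_of_nonneg_left this (by positivity)
  have hbk : β * (κ * sr) = mm / (2 * n) * sr := by rw [hβ2]; field_simp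
  have hζlo : mm / (2 * n) * (1 - 2 * τ) * g * sr ≤ ζ := by
    have : (1 - 2 * τ) * (κ * sr) ≤ specNorm Lk := by linarith
    calc _ = β * g * ((1 - 2 * τ) * (κ * sr)) := by linear_combination (-(1 - 2 * τ) * g) * hbk
      _ ≤ ζ := mul_le_mul_of_nonneg_left this (by positivity)
  have hζhi : ζ ≤ mm / (2 * n) * (1 + 2 * τ) * g * sr := by
    have : specNorm Lk ≤ (1 + 2 * τ) * (κ * sr) := by linarith
    calc ζ ≤ β * g * ((1 + 2 * τ) * (κ * sr)) := mul_le_mul_of_nonneg_left this (by positivity)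
      _ = _ := by linear_combination ((1 + 2 * τ) * g) * hbk
  have hx1 : ∀ t, ‖x t - xk t‖ ≤ mm / (2 * n) * (1 - 2 * τ) * g * sr := by
    intro t
    have h1 : ‖(x - xk) t‖ ≤ vecMaxNorm (x - xk) :=
      le_ciSup (f := fun t => ‖(x - xk) t‖) (Set.finite_range _).bddAbove t
    refine h1.trans (hxk.trans (le_of_eq ?_))
    have : (τ - 2 * τ ^ 2) / (8 * α * κ * n) = mm / (2 * n) * (1 - 2 * τ) := by
      have e : τ - 2 * τ ^ 2 = (4 * α * mm * κ) * (1 - 2 * τ) := by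
        rw [← hτm]; ring
      rw [e]; field_simp; ring
    rw [this]
  set sk := hardThreshold ζ (x + s - xk) with hsk
  set e := s - sk with he
  have hz : x + s - sk = x + e := by rw [he]; abel
  have hsum : ∑ t, ‖e t‖ ≤ α * mm * g * sr := by
    have hb := thresh_bound x s xk ζ (mm / (2 * n) * (1 - 2 * τ) * g * sr)
      hx1 hζlo
    have : ∑ t, ‖e t‖ ≤ (supp s).card * (ζ + mm / (2 * n) * (1 - 2 * τ) * g * sr) := hb
    refine this.trans ?_
    have h2 : ζ + mm / (2 * n) * (1 - 2 * τ) * g * sr ≤ mm / n * g * sr := by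
      refine (add_le_add_left hζhi _).trans (le_of_eq ?_)
      field_simp; ring
    calc _ ≤ (supp s).card * (mm / n * g * sr) :=
          mul_le_mul_of_nonneg_left h2 (Nat.cast_nonneg _)
      _ ≤ (α * n) * (mm / n * g * sr) := mul_le_mul_of_nonneg_right hs (by positivity)
      _ = _ := by field_simp
  have hE : specNorm (hankel hn e) ≤ τ / 4 * g * sr := by
    refine (hankel_norm_le hn e).trans (hsum.trans ?_)
    have h1 : α * mm ≤ τ / 4 := by
      rw [hτm]
      have : α * mm * 1 ≤ α * mm * κ := mul_le_mul_of_nonneg_left hκ1 (by positivity)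
      linarith
    gcongr
  have hT := tangent_residual hr hSVD hSVDk (hankel hn e)
  have hadd : hankel hn (x + e) = hankel hn x + hankel hn e := by
    ext i j; simp [hankel]
  rw [hz, hadd] at hLk1
  set M := tangentProj Uk Vk (hankel hn x + hankel hn e) with hM
  have hLr : (hankel hn x).rank ≤ r := by
    rw [hSVD.2.2.2.2]
    refine (rank_mul_le_left _ _).trans ((rank_mul_le_left _ _).trans ?_)
    simpa using rank_le_card_width U
  have hEY := best_approx_spec' r M Lk1 (hankel hn x) hLk1 hLr
  have hLM : specNorm (hankel hn x - M) ≤ τ * g * γ * sr := by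
    have a1 : specNorm (hankel hn x - Lk) ^ 2 / sr ≤ 4 * τ ^ 2 * g * sr := by
      have p0 : 0 ≤ specNorm (hankel hn x - Lk) := specNorm_nonneg _
      have p1 := pow_le_pow_left₀ p0 hLk 2
      rw [div_le_iff₀ hsr0]
      have : τ ^ 2 * sr ^ 2 * g * g ≤ τ ^ 2 * sr ^ 2 * g * 1 :=
        mul_le_mul_of_nonneg_left hg1 (by positivity)
      nlinarith
    have a2 : Real.sqrt (4 / 3) = 4 * Real.sqrt (1 / 12) := by
      rw [show (4 / 3 : ℝ) = 4 ^ 2 * (1 / 12) by norm_num, Real.sqrt_mul (by norm_num),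
        Real.sqrt_sq (by norm_num)]
    have a3 : Real.sqrt (4 / 3) * specNorm (hankel hn e) ≤ Real.sqrt (1 / 12) * (τ * g * sr) := by
      rw [a2]
      have := mul_le_mul_of_nonneg_left hE hsq
      linarith
    have a4 := mul_le_mul_of_nonneg_right hγ (by positivity : 0 ≤ τ * g * sr)
    refine hT.trans ?_
    rw [← hsr]
    linarith
  have tri : specNorm (hankel hn x - Lk1) ≤ specNorm (hankel hn x - M) + specNorm (M - Lk1) :=
    specNorm_tri _ _ _
  have hEY2 : specNorm (M - hankel hn x) = specNorm (hankel hn x - M) := specNorm_sub_rev _ _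
  rw [hEY2] at hEY
  rw [pow_succ, ← hg]
  linarith

end ASAP
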